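/- arXiv:cs/0508074 — 3 statements merged into one kernel-verified Lean document; each statement's English description precedes it below -/
import Mathlib

section
/- Let 0 < p < 1 and define f : ℝ → ℝ by f(x) = p·(1−p)^{x+1}/(x+1), where (1−p)^{x+1} denotes the real power exp((x+1)·log(1−p)). Then f is convex on the interval (−1, ∞). -/
/-- The function `f(x) = p (1-p)^{x+1} / (x+1)`, where `(1-p)^{x+1}` denotes the real
power `exp((x+1) log(1-p))`. -/
noncomputable def successProbFun (p x : ℝ) : ℝ :=
  p * Real.exp ((x + 1) * Real.log (1 - p)) / (x + 1)

/-- For `c ≤ 0`, the function `t ↦ exp (c t) / t` is convex on the positive half-line, as a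
product of two nonnegative, convex, antitone functions. -/
theorem convexOn_exp_mul_div {c : ℝ} (hc : c ≤ 0) :
    ConvexOn ℝ (Set.Ioi (0 : ℝ)) fun t => Real.exp (c * t) / t := by
  have hexp : ConvexOn ℝ (Set.Ioi (0 : ℝ)) fun t => Real.exp (c * t) :=
    (convexOn_exp.comp_linearMap (LinearMap.mul ℝ ℝ c)).subset (Set.subset_univ _)
      (convex_Ioi 0)
  have hinv : ConvexOn ℝ (Set.Ioi (0 : ℝ)) fun t : ℝ => t⁻¹ := by
    simpa using convexOn_zpow (𝕜 := ℝ) (-1)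
  have hexp_anti : AntitoneOn (fun t => Real.exp (c * t)) (Set.Ioi (0 : ℝ)) :=
    fun _ _ _ _ hxy => Real.exp_le_exp.2 (mul_le_mul_of_nonpos_left hxy hc)
  have hinv_anti : AntitoneOn (fun t : ℝ => t⁻¹) (Set.Ioi (0 : ℝ)) :=
    fun _ hx _ _ hxy => inv_anti₀ hx hxy
  exact hexp.mul hinv (fun _ _ => (Real.exp_pos _).le)
    (fun _ hx => inv_nonneg.2 (le_of_lt hx)) (hexp_anti.monovaryOn hinv_anti)

/-- For `0 < p < 1`, the function `f(x) = p (1-p)^{x+1}/(x+1)` is convex on `(-1, ∞)`. -/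
theorem successProbFun_convexOn (p : ℝ) (hp0 : 0 < p) (hp1 : p < 1) :
    ConvexOn ℝ (Set.Ioi (-1 : ℝ)) (successProbFun p) := by
  have hlog : Real.log (1 - p) ≤ 0 := Real.log_nonpos (by linarith) (by linarith)
  have hconv := ((convexOn_exp_mul_div hlog).smul hp0.le).translate_left 1
  have hset : (fun z : ℝ => 1 + z) ⁻¹' Set.Ioi 0 = Set.Ioi (-1) := by
    ext x
    simp [neg_lt_iff_pos_add']
  rw [hset] at hconv
  refine hconv.congr fun x _ => ?_
  simp [successProbFun, mul_div_assoc, mul_comm]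
end

section
/- Let 0 < p < 1 and define f : ℝ → ℝ by f(x) = p·(1−p)^{x+1}/(x+1), where (1−p)^{x+1} = exp((x+1)·log(1−p)). Then for every N ≥ 1 and every v₁, …, v_N ≥ 0, one has (1/N)·Σ_{k=1}^{N} f(v_k) ≥ f((1/N)·Σ_{k=1}^{N} v_k). -/
/-- For `c ≤ 0`, the function `exp (c x) / x` is convex on the positive reals. -/
theorem convexOn_exp_mul_mul_inv {c : ℝ} (hc : c ≤ 0) :
    ConvexOn ℝ (Set.Ioi 0) (fun x : ℝ => Real.exp (x * c) * x⁻¹) := by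
  have h_exp : ConvexOn ℝ (Set.Ioi 0) (fun x : ℝ => Real.exp (x * c)) := by
    refine ⟨convex_Ioi 0, fun x _ y _ a b ha hb hab => ?_⟩
    have h := convexOn_exp.2 (Set.mem_univ (x * c)) (Set.mem_univ (y * c)) ha hb hab
    simp only [smul_eq_mul] at h ⊢
    rwa [add_mul, mul_assoc, mul_assoc]
  have h_inv : ConvexOn ℝ (Set.Ioi 0) (fun x : ℝ => x⁻¹) := by
    simpa using convexOn_zpow (𝕜 := ℝ) (-1)
  refine h_exp.mul h_inv (fun x _ => (Real.exp_pos _).le)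
    (fun x hx => inv_nonneg.2 (le_of_lt hx)) ?_
  have h_anti_exp : AntitoneOn (fun x : ℝ => Real.exp (x * c)) (Set.Ioi 0) :=
    fun x _ y _ hxy => Real.exp_le_exp.2 (mul_le_mul_of_nonpos_right hxy hc)
  have h_anti_inv : AntitoneOn (fun x : ℝ => x⁻¹) (Set.Ioi 0) :=
    fun x hx y _ hxy => inv_anti₀ hx hxy
  exact h_anti_exp.monovaryOn h_anti_inv

/-- Jensen-type inequality for `f(x) = p (1-p)^{x+1}/(x+1)` with `0 < p < 1`:
for all `N ≥ 1` and `v₁, …, v_N ≥ 0`,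
`(1/N) Σ_k f(v_k) ≥ f((1/N) Σ_k v_k)`. -/
theorem successProbFun_avg_ge (p : ℝ) (hp0 : 0 < p) (hp1 : p < 1)
    (N : ℕ) (hN : 1 ≤ N) (v : Fin N → ℝ) (hv : ∀ k, 0 ≤ v k) :
    successProbFun p ((1 / (N : ℝ)) * ∑ k, v k)
      ≤ (1 / (N : ℝ)) * ∑ k, successProbFun p (v k) := by
  have hN0 : (N : ℝ) ≠ 0 := by positivity
  have hc : Real.log (1 - p) ≤ 0 := Real.log_nonpos (by linarith) (by linarith)
  have h := (convexOn_exp_mul_mul_inv hc).map_sum_le (t := Finset.univ)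
    (w := fun _ : Fin N => 1 / (N : ℝ)) (p := fun k => v k + 1)
    (fun _ _ => by positivity) (by simp [hN0])
    (fun k _ => Set.mem_Ioi.2 (by linarith [hv k]))
  have h_mean : ∑ k, (1 / (N : ℝ)) • (v k + 1) = 1 / (N : ℝ) * ∑ k, v k + 1 := by
    simp [← Finset.mul_sum, Finset.sum_add_distrib, mul_add, hN0]
  rw [h_mean, ← Finset.smul_sum, smul_eq_mul] at h
  simpa only [successProbFun, div_eq_mul_inv, mul_assoc, ← Finset.mul_sum,
    mul_left_comm _ p] using mul_le_mul_of_nonneg_left h hp0.le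
end

section
/- Let x and z be unit vectors in the Euclidean space ℝ³ and let R ∈ (0, π/2]. Then there exists a unit vector y ∈ ℝ³ with ⟨x, y⟩ = 0 and ⟨z, y⟩ ≥ cos R if and only if |⟨x, z⟩| ≤ sin R. -/
open scoped RealInnerProductSpace

section InnerProductSpace

variable {E : Type*} [NormedAddCommGroup E] [InnerProductSpace ℝ E]

theorem exists_norm_eq_one_inner_eq_zero [FiniteDimensional ℝ E]
    (hE : 1 < Module.finrank ℝ E) (x : E) : ∃ y : E, ‖y‖ = 1 ∧ ⟪x, y⟫ = 0 := by
  have hpos : 0 < Module.finrank ℝ (ℝ ∙ x)ᗮ := by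
    have hsum := (ℝ ∙ x).finrank_add_finrank_orthogonal
    have hle : Module.finrank ℝ (ℝ ∙ x) ≤ 1 :=
      (finrank_span_le_card {x}).trans (by simp)
    omega
  have : Nontrivial (ℝ ∙ x)ᗮ := Module.nontrivial_of_finrank_pos hpos
  obtain ⟨y, hy⟩ := exists_norm_eq (ℝ ∙ x)ᗮ zero_le_one
  exact ⟨y, hy, Submodule.mem_orthogonal_singleton_iff_inner_right.mp y.2⟩

theorem inner_sub_inner_smul_self_eq_zero {x : E} (hx : ‖x‖ = 1) (z : E) :
    ⟪x, z - ⟪x, z⟫ • x⟫ = 0 := by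
  simp [inner_sub_right, real_inner_smul_right, hx]

theorem inner_right_sub_inner_smul (x : E) {z : E} (hz : ‖z‖ = 1) :
    ⟪z, z - ⟪x, z⟫ • x⟫ = 1 - ⟪x, z⟫ ^ 2 := by
  rw [inner_sub_right, real_inner_smul_right, real_inner_self_eq_norm_sq, hz,
    real_inner_comm x z]
  ring

theorem norm_sub_inner_smul_sq {x z : E} (hx : ‖x‖ = 1) (hz : ‖z‖ = 1) :
    ‖z - ⟪x, z⟫ • x‖ ^ 2 = 1 - ⟪x, z⟫ ^ 2 := by
  rw [← real_inner_self_eq_norm_sq, inner_sub_left, real_inner_smul_left,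
    inner_sub_inner_smul_self_eq_zero hx, inner_right_sub_inner_smul x hz]
  ring

/-- Some unit vector orthogonal to `x` has inner product at least `c` with `z` iff `c` is
at most the length of the component of `z` orthogonal to `x`. -/
theorem exists_orthogonal_le_inner_iff [FiniteDimensional ℝ E] (hE : 1 < Module.finrank ℝ E)
    {x z : E} (hx : ‖x‖ = 1) (hz : ‖z‖ = 1) (c : ℝ) :
    (∃ y : E, ‖y‖ = 1 ∧ ⟪x, y⟫ = 0 ∧ c ≤ ⟪z, y⟫) ↔ c ≤ ‖z - ⟪x, z⟫ • x‖ := by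
  constructor
  · rintro ⟨y, hy, hxy, hzy⟩
    calc c ≤ ⟪z, y⟫ := hzy
      _ = ⟪z - ⟪x, z⟫ • x, y⟫ := by simp [inner_sub_left, real_inner_smul_left, hxy]
      _ ≤ ‖z - ⟪x, z⟫ • x‖ * ‖y‖ := real_inner_le_norm _ _
      _ = ‖z - ⟪x, z⟫ • x‖ := by rw [hy, mul_one]
  · intro hc
    have hxp := inner_sub_inner_smul_self_eq_zero hx z
    have hzp := (inner_right_sub_inner_smul x hz).trans (norm_sub_inner_smul_sq hx hz).symm
    by_cases hp : z - ⟪x, z⟫ • x = 0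
    · obtain ⟨y, hy, hxy⟩ := exists_norm_eq_one_inner_eq_zero hE x
      refine ⟨y, hy, hxy, ?_⟩
      rw [hp, norm_zero] at hc
      rwa [sub_eq_zero.mp hp, real_inner_smul_left, hxy, mul_zero]
    · have hp' := norm_ne_zero_iff.mpr hp
      refine ⟨‖z - ⟪x, z⟫ • x‖⁻¹ • (z - ⟪x, z⟫ • x), norm_smul_inv_norm hp, ?_, ?_⟩
      · rw [real_inner_smul_right, hxp, mul_zero]
      · rw [real_inner_smul_right, hzp, sq, inv_mul_cancel_left₀ hp']
        exact hc

end InnerProductSpace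

/-- A great circle (the set of unit vectors orthogonal to a unit pole `x`) intersects the
spherical cap of angular radius `R` centered at a unit vector `z` if and only if the pole
lies in the equatorial band: for unit vectors `x, z ∈ ℝ³` and `R ∈ (0, π/2]`, there is a
unit vector `y` with `⟪x, y⟫ = 0` and `⟪z, y⟫ ≥ cos R` iff `|⟪x, z⟫| ≤ sin R`. -/
theorem greatCircle_intersects_cap_iff
    (x z : EuclideanSpace ℝ (Fin 3)) (hx : ‖x‖ = 1) (hz : ‖z‖ = 1)
    (R : ℝ) (hR0 : 0 < R) (hR : R ≤ Real.pi / 2) :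
    (∃ y : EuclideanSpace ℝ (Fin 3), ‖y‖ = 1 ∧ ⟪x, y⟫ = 0 ∧ Real.cos R ≤ ⟪z, y⟫)
      ↔ |⟪x, z⟫| ≤ Real.sin R := by
  have hcos : 0 ≤ Real.cos R := Real.cos_nonneg_of_mem_Icc ⟨by linarith, hR⟩
  have hsin : 0 ≤ Real.sin R := Real.sin_nonneg_of_nonneg_of_le_pi hR0.le (by linarith)
  rw [exists_orthogonal_le_inner_iff (by simp) hx hz, ← sq_le_sq₀ hcos (norm_nonneg _),
    norm_sub_inner_smul_sq hx hz, ← sq_le_sq₀ (abs_nonneg _) hsin, sq_abs, Real.sin_sq]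
  exact le_sub_comm
end
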